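/- Let I be a directed poset, (D_i)_{i∈I} a system of extended metric spaces with nonexpanding connecting maps f_{ij} : D_i → D_j (i ≤ j), and c_i : D_i → C a compatible cocone of nonexpanding maps satisfying the colimit conditions: (1) C = ⋃_{i∈I} c_i[D_i] and (2) d_C(c_i(y), c_i(y')) = inf_{j ≥ i} d_{D_j}(f_{ij}(y), f_{ij}(y')) for all i ∈ I and y, y' ∈ D_i. Then for every n ∈ ℕ the cocone of n-th powers c_iⁿ : D_iⁿ → Cⁿ (where all powers carry the maximum metric and the connecting maps are f_{ij}ⁿ) again satisfies conditions (1) and (2); that is, finite categorical powers preserve directed colimits of extended metric spaces. -/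

import Mathlib

open ENNReal

/-- Finite categorical powers (with the maximum metric, i.e. the `Pi`
extended metric on `Fin n → ·`) preserve directed colimits of extended metric spaces:
if a cocone satisfies the two colimit conditions (collective surjectivity and the
infimum formula for distances), then so does the cocone of its `n`-th powers. -/
theorem finite_powers_preserve_directed_colimits.{u, v}
    {I : Type u} [PartialOrder I] [IsDirected I (· ≤ ·)] [Nonempty I]
    (D : I → Type v) [∀ i, EMetricSpace (D i)]
    (f : ∀ i j, i ≤ j → D i → D j)
    (hf_ne : ∀ i j (h : i ≤ j) (x y : D i), edist (f i j h x) (f i j h y) ≤ edist x y)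
    (hf_id : ∀ i (x : D i), f i i le_rfl x = x)
    (hf_comp : ∀ i j k (hij : i ≤ j) (hjk : j ≤ k) (x : D i),
      f j k hjk (f i j hij x) = f i k (hij.trans hjk) x)
    (C : Type v) [EMetricSpace C]
    (c : ∀ i, D i → C)
    (hc_ne : ∀ i (x y : D i), edist (c i x) (c i y) ≤ edist x y)
    (hc_compat : ∀ i j (h : i ≤ j) (x : D i), c j (f i j h x) = c i x)
    (h1 : ∀ x : C, ∃ i, ∃ y : D i, c i y = x)
    (h2 : ∀ i (y y' : D i), edist (c i y) (c i y') =
      ⨅ j : {j : I // i ≤ j}, edist (f i j.1 j.2 y) (f i j.1 j.2 y')) :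
    ∀ n : ℕ,
      (∀ x : Fin n → C, ∃ i, ∃ y : Fin n → D i, (fun k => c i (y k)) = x) ∧
      (∀ i (y y' : Fin n → D i),
        edist (fun k => c i (y k)) (fun k => c i (y' k)) =
          ⨅ j : {j : I // i ≤ j},
            edist (fun k => f i j.1 j.2 (y k)) (fun k => f i j.1 j.2 (y' k))) := by
  intro n
  refine ⟨fun x => ?_, fun i y y' => le_antisymm ?_ ?_⟩
  · choose i y hy using fun k => h1 (x k)
    obtain ⟨m, hm⟩ := Finite.exists_le i
    exact ⟨m, fun k => f (i k) m (hm k) (y k), funext fun k => by rw [hc_compat, hy]⟩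
  · refine le_iInf fun j => edist_pi_le_iff.2 fun k => ?_
    rw [← hc_compat i j.1 j.2, ← hc_compat i j.1 j.2]
    exact (hc_ne _ _ _).trans
      (edist_le_pi_edist (fun k => f i j.1 j.2 (y k)) (fun k => f i j.1 j.2 (y' k)) k)
  · refine le_of_forall_gt_imp_ge_of_dense fun b hb => ?_
    have hlt : ∀ k, ∃ j : {j : I // i ≤ j},
        edist (f i j.1 j.2 (y k)) (f i j.1 j.2 (y' k)) < b := fun k => by
      rw [← iInf_lt_iff, ← h2]
      exact (edist_le_pi_edist (fun k => c i (y k)) (fun k => c i (y' k)) k).trans_lt hb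
    choose j hj using hlt
    obtain ⟨m, hm⟩ := Finite.exists_le fun k => (j k).1
    obtain ⟨l, hml, hil⟩ := exists_ge_ge m i
    refine iInf_le_of_le ⟨l, hil⟩ (edist_pi_le_iff.2 fun k => ?_)
    rw [← hf_comp i (j k).1 l (j k).2 ((hm k).trans hml),
      ← hf_comp i (j k).1 l (j k).2 ((hm k).trans hml)]
    exact (hf_ne _ _ _ _ _).trans (hj k).le
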